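/- If G is a simple graph with Δ(G) ≤ 4, then a'(G) ≤ 7. -/

import Mathlib

open SimpleGraph

/-- The degree of a vertex `v` of `G` (cardinality of its neighbor set). -/
noncomputable def deg {V : Type*} (G : SimpleGraph V) (v : V) : ℕ :=
  (G.neighborSet v).ncard

/-- The maximum degree `Δ(G)` of a finite graph `G`. -/
noncomputable def maxDeg {V : Type*} [Fintype V] (G : SimpleGraph V) : ℕ :=
  Finset.univ.sup fun v => deg G v

/-- The number of neighbors of `u` in `G` whose degree is exactly `k`. -/
noncomputable def nDegEq {V : Type*} (G : SimpleGraph V) (u : V) (k : ℕ) : ℕ :=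
  {w | w ∈ G.neighborSet u ∧ deg G w = k}.ncard

/-- The number of neighbors of `u` in `G` whose degree is at most `k`. -/
noncomputable def nDegLe {V : Type*} (G : SimpleGraph V) (u : V) (k : ℕ) : ℕ :=
  {w | w ∈ G.neighborSet u ∧ deg G w ≤ k}.ncard

/-- The number of neighbors of `u` in `G` whose degree is at least `k`. -/
noncomputable def nDegGe {V : Type*} (G : SimpleGraph V) (u : V) (k : ℕ) : ℕ :=
  {w | w ∈ G.neighborSet u ∧ k ≤ deg G w}.ncard

/-- `H` is a minor of `G`: there is a family of pairwise disjoint connected branch sets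
indexed by the vertices of `H`, with an edge of `G` between the branch sets of any two
adjacent vertices of `H`. -/
def IsMinorOf {W V : Type*} (H : SimpleGraph W) (G : SimpleGraph V) : Prop :=
  ∃ φ : W → Set V,
    (∀ w, (G.induce (φ w)).Connected) ∧
    (∀ w₁ w₂, w₁ ≠ w₂ → Disjoint (φ w₁) (φ w₂)) ∧
    ∀ ⦃w₁ w₂⦄, H.Adj w₁ w₂ → ∃ a ∈ φ w₁, ∃ b ∈ φ w₂, G.Adj a b

/-- A graph is planar iff it can be embedded in the plane; by Wagner's theorem this is
equivalent to having neither a `K₅` nor a `K₃,₃` minor. -/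
def IsPlanar {V : Type*} (G : SimpleGraph V) : Prop :=
  ¬ IsMinorOf (completeGraph (Fin 5)) G ∧
  ¬ IsMinorOf (completeBipartiteGraph (Fin 3) (Fin 3)) G

/-- A graph is 2-connected: it has at least 3 vertices and deleting any single vertex
leaves a connected graph. -/
def TwoConnected {V : Type*} [Fintype V] (G : SimpleGraph V) : Prop :=
  3 ≤ Fintype.card V ∧ ∀ v : V, (G.induce {w | w ≠ v}).Connected

/-- A proper edge coloring: distinct edges sharing a vertex get different colors. -/
def ProperEdgeColoring {V α : Type*} (G : SimpleGraph V) (c : Sym2 V → α) : Prop :=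
  ∀ e₁ ∈ G.edgeSet, ∀ e₂ ∈ G.edgeSet, e₁ ≠ e₂ → (∃ v, v ∈ e₁ ∧ v ∈ e₂) → c e₁ ≠ c e₂

/-- An acyclic edge coloring: a proper edge coloring with no bichromatic cycle. -/
def AcyclicEdgeColoring {V α : Type*} (G : SimpleGraph V) (c : Sym2 V → α) : Prop :=
  ProperEdgeColoring G c ∧
  ∀ (v : V) (w : G.Walk v v), w.IsCycle →
    ¬ ∃ i j : α, ∀ e ∈ w.edges, c e = i ∨ c e = j

/-- Configuration (A₁): a path `u v w` with `d(v) = 2` and `d(u) ≤ 9`. -/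
def ConfigA1 {V : Type*} (G : SimpleGraph V) : Prop :=
  ∃ u v w : V, G.Adj u v ∧ G.Adj v w ∧ u ≠ w ∧ deg G v = 2 ∧ deg G u ≤ 9

/-- Configuration (A₂). -/
def ConfigA2 {V : Type*} (G : SimpleGraph V) : Prop :=
  ∃ u : V, 1 ≤ nDegEq G u 2 ∧
    ((deg G u : ℤ) - 7 ≤ (nDegLe G u 8 : ℤ) ∨
     ((nDegLe G u 8 : ℤ) = (deg G u : ℤ) - 8 ∧ (deg G u : ℤ) - 9 ≤ (nDegEq G u 2 : ℤ)))

/-- Configuration (A₃). -/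
def ConfigA3 {V : Type*} (G : SimpleGraph V) : Prop :=
  ∃ u v : V, G.Adj u v ∧ deg G u = 3 ∧
    (deg G v ≤ 8 ∨
     (deg G v = 9 ∧ ∃ w, G.Adj u w ∧ G.Adj v w) ∨
     (deg G v = 10 ∧ 5 ≤ nDegLe G v 5 ∧
       ∃ w₁ w₂, w₁ ≠ w₂ ∧ G.Adj u w₁ ∧ G.Adj v w₁ ∧ G.Adj u w₂ ∧ G.Adj v w₂))

/-- Configuration (A₄). -/
def ConfigA4 {V : Type*} (G : SimpleGraph V) : Prop :=
  (∃ v u v₂ v₃ v₄ : V,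
     deg G v = 4 ∧
     G.Adj v u ∧ G.Adj v v₂ ∧ G.Adj v v₃ ∧ G.Adj v v₄ ∧
     ([u, v₂, v₃, v₄] : List V).Pairwise (· ≠ ·) ∧
     deg G u ≤ deg G v₂ ∧ deg G v₂ ≤ deg G v₃ ∧ deg G v₃ ≤ deg G v₄ ∧
     4 ≤ deg G u ∧ deg G u ≤ 7 ∧ deg G u + deg G v₂ ≤ 17) ∨
  (∃ v u v₂ v₃ v₄ v₅ : V,
     deg G v = 5 ∧
     G.Adj v u ∧ G.Adj v v₂ ∧ G.Adj v v₃ ∧ G.Adj v v₄ ∧ G.Adj v v₅ ∧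
     ([u, v₂, v₃, v₄, v₅] : List V).Pairwise (· ≠ ·) ∧
     deg G u ≤ deg G v₂ ∧ deg G v₂ ≤ deg G v₃ ∧ deg G v₃ ≤ deg G v₄ ∧
       deg G v₄ ≤ deg G v₅ ∧
     ((4 ≤ deg G u ∧ deg G u ≤ 6 ∧ deg G u + deg G v₂ + deg G v₃ ≤ 18) ∨
      (deg G u = 6 ∧ deg G v₂ = 6 ∧ deg G v₃ = 7 ∧ deg G v₄ = 7 ∧ deg G v₅ = 7 ∧
        G.Adj u v₅)))

/-- Bit masks of the 3-element subsets of `{0, …, 6}`. -/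
def tripleMasks : List ℕ :=
  [7, 11, 13, 14, 19, 21, 22, 25, 26, 28, 35, 37, 38, 41, 42, 44, 49, 50, 52, 56, 67, 69, 70,
    73, 74, 76, 81, 82, 84, 88, 97, 98, 100, 104, 112]

/-- Up to a permutation of the colors, a pair of 3-element sets is given by the mask `7` and one of
these masks. -/
def secondMasks : List ℕ := [7, 14, 28, 56]

/-- The seven colors. -/
def palette : List ℕ := [0, 1, 2, 3, 4, 5, 6]

/-- The `i`-th bit of `m`, written with operations that are cheap to evaluate. -/
def bit (m i : ℕ) : Bool := Nat.beq (Nat.land (Nat.shiftRight m i) 1) 1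

/-- Two vertices seeing the colors in `m` and `n` may get the distinct colors `a` and `b`, and
not both of these colors are seen by the other vertex. -/
def compatible (m n a b : ℕ) : Bool :=
  bif Nat.beq a b then false else bif bit m b then !bit n a else true

/-- Some color outside of the mask `m` satisfies `P`. -/
def anyColor (m : ℕ) (P : ℕ → Bool) : Bool :=
  palette.any fun a => bif bit m a then false else P a

/-- The colors `a`, `b` at the first two vertices extend to an assignment of colors in which
all pairs, except possibly the first one, are compatible. -/
def extendsPair (m₀ m₁ m₂ m₃ a b : ℕ) : Bool :=
  anyColor m₂ fun c => compatible m₀ m₂ a c && (compatible m₁ m₂ b c &&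
    anyColor m₃ fun d => compatible m₀ m₃ a d && (compatible m₁ m₃ b d && compatible m₂ m₃ c d))

/-- There is an assignment of pairwise compatible colors. -/
def hasCompatible (m₀ m₁ m₂ m₃ : ℕ) : Bool :=
  anyColor m₀ fun a => anyColor m₁ fun b =>
    compatible m₀ m₁ a b && extendsPair m₀ m₁ m₂ m₃ a b

/-- There are two assignments whose only incompatible pairs cannot both be linked. -/
def hasConflict (m₀ m₁ m₂ m₃ : ℕ) : Bool :=
  anyColor m₀ fun a => anyColor m₁ fun b => !Nat.beq a b && (extendsPair m₀ m₁ m₂ m₃ a b &&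
    ((!bit m₂ b && extendsPair m₀ m₂ m₁ m₃ a b) ||
      (!bit m₀ b && (!bit m₂ a && extendsPair m₀ m₂ m₁ m₃ b a))))

/-- Every color occurs in an even number of the masks. -/
def isBalanced (m₀ m₁ m₂ m₃ : ℕ) : Bool :=
  palette.all fun x => bit m₃ x == (bit m₀ x ^^ (bit m₁ x ^^ bit m₂ x))

theorem hasCompatible_or_isBalanced_or_hasConflict :
    (secondMasks.all fun m₁ => tripleMasks.all fun m₂ => tripleMasks.all fun m₃ =>
      hasCompatible 7 m₁ m₂ m₃ || (isBalanced 7 m₁ m₂ m₃ ||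
      (hasConflict 7 m₁ m₂ m₃ || (hasConflict 7 m₁ m₃ m₂ || (hasConflict 7 m₂ m₃ m₁ ||
      (hasConflict m₁ 7 m₂ m₃ || (hasConflict m₁ 7 m₃ m₂ || (hasConflict m₁ m₂ m₃ 7 ||
      (hasConflict m₂ 7 m₁ m₃ || (hasConflict m₂ 7 m₃ m₁ || (hasConflict m₂ m₁ m₃ 7 ||
      (hasConflict m₃ 7 m₁ m₂ || (hasConflict m₃ 7 m₂ m₁ ||
        hasConflict m₃ m₁ m₂ 7))))))))))))) = true := by
  decide +kernel

/-- Compatibility, where a pair with one vertex of a triangle may also be incompatible if its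
colors are linked through the edge of color `g` between the vertices with masks `m₀` and `m₁`. -/
def compatibleVia (g m₀ m₁ m n a b : ℕ) : Bool :=
  compatible m n a b || (!Nat.beq a b && (Nat.beq b g && (!bit m₀ a && !bit m₁ a)))

/-- There is an assignment whose incompatible pairs cannot be linked, given an edge of color `g`
between the first two vertices. -/
def hasTriangleAssignment (g m₀ m₁ m₂ m₃ : ℕ) : Bool :=
  anyColor m₀ fun a => anyColor m₁ fun b => compatible m₀ m₁ a b &&
    anyColor m₂ fun c => compatibleVia g m₀ m₁ m₀ m₂ a c && (compatibleVia g m₀ m₁ m₁ m₂ b c &&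
      anyColor m₃ fun d => compatibleVia g m₀ m₁ m₀ m₃ a d &&
        (compatibleVia g m₀ m₁ m₁ m₃ b d && compatible m₂ m₃ c d))

theorem hasTriangleAssignment_of_isBalanced :
    (secondMasks.all fun m₁ => tripleMasks.all fun m₂ => tripleMasks.all fun m₃ =>
      !isBalanced 7 m₁ m₂ m₃ || (palette.all fun g => !bit 7 g || (!bit m₁ g ||
        hasTriangleAssignment g 7 m₁ m₂ m₃))) = true := by
  decide +kernel

/-- Some assignment of pairwise compatible colors to three vertices satisfies `P`. -/
def anyTriple (m₀ m₁ m₂ : ℕ) (P : ℕ → ℕ → ℕ → Bool) : Bool :=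
  anyColor m₀ fun a => anyColor m₁ fun b => compatible m₀ m₁ a b &&
    anyColor m₂ fun c => compatible m₀ m₂ a c && (compatible m₁ m₂ b c && P a b c)

theorem anyTriple_anyTriple :
    (secondMasks.all fun m₁ => tripleMasks.all fun m₂ =>
      anyTriple 7 m₁ m₂ fun a b c => anyTriple 7 m₁ m₂ fun a' b' c' =>
        !Nat.beq a a' && (!Nat.beq a b' && !Nat.beq a c') ||
        (!Nat.beq b a' && (!Nat.beq b b' && !Nat.beq b c') ||
        (!Nat.beq c a' && (!Nat.beq c b' && !Nat.beq c c')))) = true := by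
  decide +kernel

theorem exists_of_anyColor {m : ℕ} {P : ℕ → Bool} (h : anyColor m P = true) :
    ∃ a, a < 7 ∧ bit m a = false ∧ P a = true := by
  obtain ⟨a, ha, h⟩ := List.any_eq_true.1 h
  refine ⟨a, ?_, ?_⟩
  · simp only [palette, List.mem_cons, List.not_mem_nil, or_false] at ha
    omega
  · cases hb : bit m a <;> simp_all

theorem compatible_iff {m n a b : ℕ} :
    compatible m n a b = true ↔ a ≠ b ∧ ¬ (bit m b = true ∧ bit n a = true) := by
  have : Nat.beq a b = true ↔ a = b := ⟨Nat.eq_of_beq_eq_true, fun h => h ▸ Nat.beq_refl a⟩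
  unfold compatible
  cases h : Nat.beq a b <;> cases bit m b <;> cases bit n a <;> simp_all

theorem beq_eq_false {a b : ℕ} (h : (!Nat.beq a b) = true) : a ≠ b := by
  rintro rfl
  simp [Nat.beq_refl] at h

theorem exists_mask (F : Finset (Fin 7)) (hF : F.card = 3) :
    ∃ m ∈ tripleMasks, ∀ x : Fin 7, bit m x = true ↔ x ∈ F := by
  have key : ∀ x y z : Fin 7, x ≠ y → x ≠ z → y ≠ z →
      ∃ m ∈ tripleMasks, ∀ w : Fin 7, bit m w = true ↔ (w = x ∨ w = y ∨ w = z) := by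
    decide +kernel
  obtain ⟨x, y, z, hxy, hxz, hyz, rfl⟩ := Finset.card_eq_three.1 hF
  simpa using key x y z hxy hxz hyz

/-- Two 3-element sets of colors can be brought into standard position. -/
theorem exists_perm_masks (F₀ F₁ : Finset (Fin 7)) (h₀ : F₀.card = 3) (h₁ : F₁.card = 3) :
    ∃ σ : Equiv.Perm (Fin 7), ∃ m ∈ secondMasks,
      (∀ x, bit 7 (σ x) = true ↔ x ∈ F₀) ∧ ∀ x, bit m (σ x) = true ↔ x ∈ F₁ := by
  have key : ∀ t : Fin 4, ∃ m ∈ secondMasks,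
      (Finset.univ.filter fun x : Fin 7 => bit 7 x = true ∧ bit m x = true).card = t ∧
      (Finset.univ.filter fun x : Fin 7 => bit 7 x = true).card = 3 ∧
      (Finset.univ.filter fun x : Fin 7 => bit m x = true).card = 3 := by
    decide +kernel
  have ht : (F₀ ∩ F₁).card < 4 := by
    have := Finset.card_le_card (Finset.inter_subset_left (s₁ := F₀) (s₂ := F₁))
    omega
  obtain ⟨m, hm, h, h', h''⟩ := key ⟨_, ht⟩
  have hc : ∀ (p q : Fin 7 → Bool) (t : ℕ),
      (Finset.univ.filter fun x => p x = true ∧ q x = true).card = t →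
      (Finset.univ.filter fun x => p x = true).card = 3 →
      (Finset.univ.filter fun x => q x = true).card = 3 → ∀ c : Bool × Bool,
      Fintype.card {x // (p x, q x) = c} =
        bif c.1 then (bif c.2 then t else 3 - t) else (bif c.2 then 3 - t else t + 1) := by
    intro p q t h1 h2 h3 c
    have e1 := Finset.card_filter_add_card_filter_not (s := Finset.univ.filter fun x => p x = true)
      (fun x => q x = true)
    have e2 := Finset.card_filter_add_card_filter_not (s := Finset.univ.filter fun x => q x = true)
      (fun x => p x = true)
    have e3 := Finset.card_filter_add_card_filter_not (s := (Finset.univ : Finset (Fin 7)))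
      (fun x => p x = true)
    have e4 := Finset.card_filter_add_card_filter_not
      (s := Finset.univ.filter fun x => ¬ p x = true) (fun x => q x = true)
    simp only [Finset.filter_filter, Finset.card_univ, Fintype.card_fin] at e1 e2 e3 e4
    rw [Fintype.card_subtype]
    have e5 : (Finset.univ.filter fun x => q x = true ∧ p x = true) =
      Finset.univ.filter fun x => p x = true ∧ q x = true := by
      ext; simp [and_comm]
    have e6 : (Finset.univ.filter fun x => q x = true ∧ ¬ p x = true) =
      Finset.univ.filter fun x => ¬ p x = true ∧ q x = true := by
      ext; simp [and_comm]
    rw [e5, e6] at e2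
    rcases c with ⟨_ | _, _ | _⟩ <;> simp_all <;> omega
  let p : Fin 7 → Bool × Bool := fun x => (decide (x ∈ F₀), decide (x ∈ F₁))
  let q : Fin 7 → Bool × Bool := fun x => (bit 7 x, bit m x)
  have hpq : ∀ c, Fintype.card {x // p x = c} = Fintype.card {x // q x = c} := by
    intro c
    rw [hc (fun x => decide (x ∈ F₀)) (fun x => decide (x ∈ F₁)) (F₀ ∩ F₁).card ?_ ?_ ?_ c,
      hc _ _ _ h h' h'' c]
    · congr 1; ext; simp
    · simpa using h₀
    · simpa using h₁
  refine ⟨Equiv.ofFiberEquiv (f := p) (g := q) fun c => Fintype.equivOfCardEq (hpq c), m, hm,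
    fun x => ?_, fun x => ?_⟩
  · have := Equiv.ofFiberEquiv_map (f := p) (g := q) (fun c => Fintype.equivOfCardEq (hpq c)) x
    have := congrArg Prod.fst this
    simp only [p, q] at this
    rw [this]
    simp
  · have := Equiv.ofFiberEquiv_map (f := p) (g := q) (fun c => Fintype.equivOfCardEq (hpq c)) x
    have := congrArg Prod.snd this
    simp only [p, q] at this
    rw [this]
    simp

/-- The abstract properties of bichromatic paths between four vertices, where `F i` contains the
colors seen by the `i`-th vertex, and `L i j a b` states that the vertices `i` and `j` are linked
by a path whose edges have colors `a` and `b`. -/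
structure IsLinkage (F : Fin 4 → Finset (Fin 7))
    (L : Fin 4 → Fin 4 → Fin 7 → Fin 7 → Prop) : Prop where
  symm : ∀ {i j a b}, L i j a b → L j i a b
  swap : ∀ {i j a b}, L i j a b → L i j b a
  mem : ∀ {i j a b}, L i j a b → i ≠ j → a ≠ b → a ∉ F i → b ∉ F j → b ∈ F i ∧ a ∈ F j
  unique : ∀ {i j k a b}, L i j a b → L i k a b → i ≠ j → i ≠ k → j ≠ k → a ≠ b →
    (a ∉ F i ∨ b ∉ F i) → (a ∉ F j ∨ b ∉ F j) → (a ∉ F k ∨ b ∉ F k) → False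

/-- Distinct colors for the four vertices that are neither seen nor close a bichromatic cycle. -/
def IsAssignment (F : Fin 4 → Finset (Fin 7)) (L : Fin 4 → Fin 4 → Fin 7 → Fin 7 → Prop)
    (f : Fin 4 → Fin 7) : Prop :=
  Function.Injective f ∧ (∀ i, f i ∉ F i) ∧ ∀ i j, i ≠ j → ¬ L i j (f i) (f j)

/-- Every color occurs in an even number of the sets. -/
def EvenlyCovered (F : Fin 4 → Finset (Fin 7)) : Prop :=
  ∀ x, (x ∈ F 3 ↔ Xor (x ∈ F 0) (Xor (x ∈ F 1) (x ∈ F 2)))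

/-- The masks `m` encode the sets `F` after decoding colors by `e`. -/
structure IsEncoding (F : Fin 4 → Finset (Fin 7)) (e : ℕ → Fin 7) (m : Fin 4 → ℕ) : Prop where
  inj : ∀ {a b}, a < 7 → b < 7 → e a = e b → a = b
  bit_iff : ∀ i {a}, a < 7 → (bit (m i) a = true ↔ e a ∈ F i)

section Assignment

variable {F : Fin 4 → Finset (Fin 7)} {L : Fin 4 → Fin 4 → Fin 7 → Fin 7 → Prop}
  {e : ℕ → Fin 7} {m : Fin 4 → ℕ}

theorem IsEncoding.notMem (he : IsEncoding F e m) {i : Fin 4} {a : ℕ} (ha : a < 7)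
    (h : bit (m i) a = false) : e a ∉ F i := by
  rw [← he.bit_iff i ha, h]
  simp

theorem IsLinkage.not_of_compatible (hL : IsLinkage F L) (he : IsEncoding F e m) {i j : Fin 4}
    (hij : i ≠ j) {a b : ℕ} (ha : a < 7) (hb : b < 7) (hia : bit (m i) a = false)
    (hjb : bit (m j) b = false) (h : compatible (m i) (m j) a b = true) :
    ¬ L i j (e a) (e b) := by
  intro hl
  obtain ⟨hab, h⟩ := compatible_iff.1 h
  rw [he.bit_iff i hb, he.bit_iff j ha] at h
  exact h (hL.mem hl hij (fun h => hab (he.inj ha hb h)) (he.notMem ha hia) (he.notMem hb hjb))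

/-- Pairwise distinct indices and colors give an assignment as soon as the six pairs are not
linked. -/
theorem isAssignment_of_pairs (hL : IsLinkage F L) (he : IsEncoding F e m) {i j k l : Fin 4}
    (hij : i ≠ j) (hik : i ≠ k) (hil : i ≠ l) (hjk : j ≠ k) (hjl : j ≠ l) (hkl : k ≠ l)
    {a b c d : ℕ} (ha : a < 7) (hb : b < 7) (hc : c < 7) (hd : d < 7)
    (hab : a ≠ b) (hac : a ≠ c) (had : a ≠ d) (hbc : b ≠ c) (hbd : b ≠ d) (hcd : c ≠ d)
    (hia : bit (m i) a = false) (hjb : bit (m j) b = false) (hkc : bit (m k) c = false)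
    (hld : bit (m l) d = false)
    (lij : ¬ L i j (e a) (e b)) (lik : ¬ L i k (e a) (e c)) (lil : ¬ L i l (e a) (e d))
    (ljk : ¬ L j k (e b) (e c)) (ljl : ¬ L j l (e b) (e d)) (lkl : ¬ L k l (e c) (e d)) :
    ∃ f, IsAssignment F L f := by
  have cover : ∀ t : Fin 4, t = i ∨ t = j ∨ t = k ∨ t = l := by
    clear * - hij hik hil hjk hjl hkl
    revert i j k l
    decide +kernel
  let f : Fin 4 → Fin 7 := fun t =>
    if t = i then e a else if t = j then e b else if t = k then e c else e d
  have fi : f i = e a := by simp [f]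
  have fj : f j = e b := by simp [f, hij.symm]
  have fk : f k = e c := by simp [f, hik.symm, hjk.symm]
  have fl : f l = e d := by simp [f, hil.symm, hjl.symm, hkl.symm]
  have ne : ∀ {x y}, x < 7 → y < 7 → x ≠ y → e x ≠ e y := fun hx hy h h' => h (he.inj hx hy h')
  refine ⟨f, fun s t hst => ?_, fun t => ?_, fun s t hst hl => ?_⟩
  · have nab := ne ha hb hab
    have nac := ne ha hc hac
    have nad := ne ha hd had
    have nbc := ne hb hc hbc
    have nbd := ne hb hd hbd
    have ncd := ne hc hd hcd
    rcases cover s with h | h | h | h <;> rcases cover t with h' | h' | h' | h' <;>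
      rw [h, h'] at hst ⊢ <;> simp only [fi, fj, fk, fl] at hst <;>
      first
      | exact absurd hst ‹_›
      | exact absurd hst.symm ‹_›
  · rcases cover t with rfl | rfl | rfl | rfl
    · exact fi ▸ he.notMem ha hia
    · exact fj ▸ he.notMem hb hjb
    · exact fk ▸ he.notMem hc hkc
    · exact fl ▸ he.notMem hd hld
  · have hl' := hL.swap (hL.symm hl)
    rcases cover s with h | h | h | h <;> rcases cover t with h' | h' | h' | h' <;>
      rw [h, h'] at hst hl hl' <;> simp only [fi, fj, fk, fl] at hl hl' <;>
      first
      | exact absurd rfl hst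
      | exact absurd hl ‹_›
      | exact absurd hl' ‹_›

theorem IsLinkage.linked_of_extendsPair (hL : IsLinkage F L) (he : IsEncoding F e m)
    (hno : ¬ ∃ f, IsAssignment F L f) {i j k l : Fin 4}
    (hij : i ≠ j) (hik : i ≠ k) (hil : i ≠ l) (hjk : j ≠ k) (hjl : j ≠ l) (hkl : k ≠ l)
    {a b : ℕ} (ha : a < 7) (hb : b < 7) (hab : a ≠ b) (hia : bit (m i) a = false)
    (hjb : bit (m j) b = false) (h : extendsPair (m i) (m j) (m k) (m l) a b = true) :
    L i j (e a) (e b) := by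
  obtain ⟨c, hc, hkc, h⟩ := exists_of_anyColor h
  simp only [Bool.and_eq_true] at h
  obtain ⟨hac, hbc, h⟩ := h
  obtain ⟨d, hd, hld, h⟩ := exists_of_anyColor h
  simp only [Bool.and_eq_true] at h
  obtain ⟨had, hbd, hcd⟩ := h
  by_contra hl
  exact hno (isAssignment_of_pairs hL he hij hik hil hjk hjl hkl ha hb hc hd hab
    (compatible_iff.1 hac).1 (compatible_iff.1 had).1 (compatible_iff.1 hbc).1
    (compatible_iff.1 hbd).1 (compatible_iff.1 hcd).1 hia hjb hkc hld hl
    (hL.not_of_compatible he hik ha hc hia hkc hac) (hL.not_of_compatible he hil ha hd hia hld had)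
    (hL.not_of_compatible he hjk hb hc hjb hkc hbc) (hL.not_of_compatible he hjl hb hd hjb hld hbd)
    (hL.not_of_compatible he hkl hc hd hkc hld hcd))

theorem IsLinkage.exists_of_hasCompatible (hL : IsLinkage F L) (he : IsEncoding F e m)
    (h : hasCompatible (m 0) (m 1) (m 2) (m 3) = true) : ∃ f, IsAssignment F L f := by
  by_contra hno
  obtain ⟨a, ha, h0a, h⟩ := exists_of_anyColor h
  obtain ⟨b, hb, h1b, h⟩ := exists_of_anyColor h
  simp only [Bool.and_eq_true] at h
  exact hL.not_of_compatible he (by decide) ha hb h0a h1b h.1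
    (hL.linked_of_extendsPair he hno (by decide) (by decide) (by decide) (by decide) (by decide)
      (by decide) ha hb (compatible_iff.1 h.1).1 h0a h1b h.2)

theorem IsLinkage.exists_of_hasConflict (hL : IsLinkage F L) (he : IsEncoding F e m)
    {i j k l : Fin 4} (hij : i ≠ j) (hik : i ≠ k) (hil : i ≠ l) (hjk : j ≠ k) (hjl : j ≠ l)
    (hkl : k ≠ l) (h : hasConflict (m i) (m j) (m k) (m l) = true) :
    ∃ f, IsAssignment F L f := by
  by_contra hno
  obtain ⟨a, ha, hia, h⟩ := exists_of_anyColor h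
  obtain ⟨b, hb, hjb, h⟩ := exists_of_anyColor h
  simp only [Bool.and_eq_true, Bool.or_eq_true, Bool.not_eq_true'] at h
  obtain ⟨hab, h, h'⟩ := h
  have hab : a ≠ b := beq_eq_false (by simp [hab])
  have hl := hL.linked_of_extendsPair he hno hij hik hil hjk hjl hkl ha hb hab hia hjb h
  have hne : e a ≠ e b := fun h => hab (he.inj ha hb h)
  rcases h' with ⟨hkb, h'⟩ | ⟨hib, hka, h'⟩
  · have hl' := hL.linked_of_extendsPair he hno hik hij hil hjk.symm hkl hjl ha hb hab hia hkb h'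
    exact hL.unique hl hl' hij hik hjk hne (.inl (he.notMem ha hia)) (.inr (he.notMem hb hjb))
      (.inr (he.notMem hb hkb))
  · have hl' := hL.linked_of_extendsPair he hno hik hij hil hjk.symm hkl hjl hb ha hab.symm hib
      hka h'
    exact hL.unique hl (hL.swap hl') hij hik hjk hne (.inl (he.notMem ha hia))
      (.inr (he.notMem hb hjb)) (.inl (he.notMem ha hka))

theorem IsEncoding.isBalanced_iff (he : IsEncoding F e m) (hs : ∀ x, ∃ a, a < 7 ∧ e a = x) :
    isBalanced (m 0) (m 1) (m 2) (m 3) = true ↔ EvenlyCovered F := by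
  have key : ∀ a, a < 7 → (bit (m 3) a = (bit (m 0) a ^^ (bit (m 1) a ^^ bit (m 2) a)) ↔
      (e a ∈ F 3 ↔ Xor (e a ∈ F 0) (Xor (e a ∈ F 1) (e a ∈ F 2)))) := by
    intro a ha
    simp only [← he.bit_iff _ ha]
    cases bit (m 0) a <;> cases bit (m 1) a <;> cases bit (m 2) a <;> cases bit (m 3) a <;>
      simp [Xor]
  simp only [isBalanced, List.all_eq_true, beq_iff_eq]
  constructor
  · intro h x
    obtain ⟨a, ha, rfl⟩ := hs x
    refine (key a ha).1 (h a ?_)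
    simp only [palette, List.mem_cons, List.not_mem_nil, or_false]
    omega
  · intro h a ha
    refine (key a ?_).2 (h _)
    simp only [palette, List.mem_cons, List.not_mem_nil, or_false] at ha
    omega

theorem exists_isEncoding (hF : ∀ i, (F i).card = 3) :
    ∃ e m₁ m₂ m₃, m₁ ∈ secondMasks ∧ m₂ ∈ tripleMasks ∧ m₃ ∈ tripleMasks ∧
      IsEncoding F e ![7, m₁, m₂, m₃] ∧ ∀ x, ∃ a, a < 7 ∧ e a = x := by
  obtain ⟨σ, m₁, hm₁, h₀, h₁⟩ := exists_perm_masks (F 0) (F 1) (hF 0) (hF 1)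
  obtain ⟨m₂, hm₂, h₂⟩ := exists_mask ((F 2).map σ.toEmbedding) (by simpa using hF 2)
  obtain ⟨m₃, hm₃, h₃⟩ := exists_mask ((F 3).map σ.toEmbedding) (by simpa using hF 3)
  refine ⟨fun a => σ.symm (Fin.ofNat 7 a), m₁, m₂, m₃, hm₁, hm₂, hm₃, ⟨?_, ?_⟩, ?_⟩
  · intro a b ha hb h
    have := congrArg Fin.val (σ.symm.injective h)
    simpa [Fin.ofNat, Nat.mod_eq_of_lt ha, Nat.mod_eq_of_lt hb] using this
  · intro i a ha
    obtain ⟨x, hx⟩ : ∃ x, σ x = Fin.ofNat 7 a := σ.surjective _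
    obtain rfl : ((σ x : Fin 7) : ℕ) = a := by rw [hx]; simp [Fin.ofNat, Nat.mod_eq_of_lt ha]
    have hx : σ.symm (Fin.ofNat 7 (σ x)) = x := by rw [← hx, Equiv.symm_apply_apply]
    rw [hx]
    fin_cases i
    · exact h₀ x
    · exact h₁ x
    · simpa using h₂ (σ x)
    · simpa using h₃ (σ x)
  · intro x
    exact ⟨σ x, (σ x).2, by simp⟩

theorem IsLinkage.exists_of_not_evenlyCovered (hL : IsLinkage F L) (hF : ∀ i, (F i).card = 3)
    (hb : ¬ EvenlyCovered F) : ∃ f, IsAssignment F L f := by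
  obtain ⟨e, m₁, m₂, m₃, h₁, h₂, h₃, he, hs⟩ := exists_isEncoding hF
  have h := hasCompatible_or_isBalanced_or_hasConflict
  simp only [List.all_eq_true] at h
  have h := h m₁ h₁ m₂ h₂ m₃ h₃
  simp only [Bool.or_eq_true] at h
  have hc := @IsLinkage.exists_of_hasConflict _ _ _ _ hL he
  rcases h with h | h | h | h | h | h | h | h | h | h | h | h | h | h
  · exact hL.exists_of_hasCompatible he h
  · exact absurd ((he.isBalanced_iff hs).1 h) hb
  · exact @hc 0 1 2 3 (by decide) (by decide) (by decide) (by decide) (by decide) (by decide) h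
  · exact @hc 0 1 3 2 (by decide) (by decide) (by decide) (by decide) (by decide) (by decide) h
  · exact @hc 0 2 3 1 (by decide) (by decide) (by decide) (by decide) (by decide) (by decide) h
  · exact @hc 1 0 2 3 (by decide) (by decide) (by decide) (by decide) (by decide) (by decide) h
  · exact @hc 1 0 3 2 (by decide) (by decide) (by decide) (by decide) (by decide) (by decide) h
  · exact @hc 1 2 3 0 (by decide) (by decide) (by decide) (by decide) (by decide) (by decide) h
  · exact @hc 2 0 1 3 (by decide) (by decide) (by decide) (by decide) (by decide) (by decide) h
  · exact @hc 2 0 3 1 (by decide) (by decide) (by decide) (by decide) (by decide) (by decide) h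
  · exact @hc 2 1 3 0 (by decide) (by decide) (by decide) (by decide) (by decide) (by decide) h
  · exact @hc 3 0 1 2 (by decide) (by decide) (by decide) (by decide) (by decide) (by decide) h
  · exact @hc 3 0 2 1 (by decide) (by decide) (by decide) (by decide) (by decide) (by decide) h
  · exact @hc 3 1 2 0 (by decide) (by decide) (by decide) (by decide) (by decide) (by decide) h

/-- An edge of color `g` between the first two vertices excludes the links required by
incompatible pairs of `compatibleVia`. -/
theorem IsLinkage.not_of_compatibleVia (hL : IsLinkage F L) (he : IsEncoding F e m) {g : ℕ}
    (hg : g < 7) (hlink : ∀ b, b ∉ F 0 → b ∉ F 1 → L 0 1 (e g) b) {i j : Fin 4}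
    (hi : i = 0 ∨ i = 1) (hj : j = 2 ∨ j = 3) {a b : ℕ} (ha : a < 7) (hb : b < 7)
    (hia : bit (m i) a = false) (hjb : bit (m j) b = false)
    (h : compatibleVia g (m 0) (m 1) (m i) (m j) a b = true) :
    a ≠ b ∧ ¬ L i j (e a) (e b) := by
  simp only [compatibleVia, Bool.or_eq_true, Bool.and_eq_true, Bool.not_eq_true'] at h
  have hij : i ≠ j := by omega
  rcases h with h | ⟨hab, hbg, h0, h1⟩
  · exact ⟨(compatible_iff.1 h).1, hL.not_of_compatible he hij ha hb hia hjb h⟩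
  · have hab : a ≠ b := beq_eq_false (by simp [hab])
    obtain rfl := Nat.eq_of_beq_eq_true hbg
    refine ⟨hab, fun hl => ?_⟩
    have h0 := he.notMem ha h0
    have h1 := he.notMem ha h1
    have hl' := hL.swap (hlink _ h0 h1)
    have hne : e a ≠ e b := fun h => hab (he.inj ha hb h)
    have hjb := he.notMem hb hjb
    rcases hi with rfl | rfl
    · exact hL.unique hl hl' hij (by decide) (by omega) hne (.inl h0) (.inr hjb) (.inl h1)
    · exact hL.unique hl (hL.symm hl') hij (by decide) (by omega) hne (.inl h1) (.inr hjb)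
        (.inl h0)

theorem IsLinkage.exists_of_evenlyCovered (hL : IsLinkage F L) (hF : ∀ i, (F i).card = 3)
    (hb : EvenlyCovered F) {g : Fin 7} (h0 : g ∈ F 0) (h1 : g ∈ F 1)
    (hlink : ∀ b, b ∉ F 0 → b ∉ F 1 → L 0 1 g b) : ∃ f, IsAssignment F L f := by
  obtain ⟨e, m₁, m₂, m₃, h₁, h₂, h₃, he, hs⟩ := exists_isEncoding hF
  obtain ⟨g, hg, rfl⟩ := hs g
  have h := hasTriangleAssignment_of_isBalanced
  simp only [List.all_eq_true] at h
  have h := h m₁ h₁ m₂ h₂ m₃ h₃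
  have hb : isBalanced 7 m₁ m₂ m₃ = true := (he.isBalanced_iff hs).2 hb
  rw [hb] at h
  simp only [Bool.not_true, Bool.false_or, List.all_eq_true] at h
  have h0 : bit 7 g = true := (he.bit_iff 0 hg).2 h0
  have h1 : bit m₁ g = true := (he.bit_iff 1 hg).2 h1
  have h := h g (by simp only [palette, List.mem_cons, List.not_mem_nil, or_false]; omega)
  rw [h0, h1] at h
  simp only [Bool.not_true, Bool.false_or] at h
  obtain ⟨a, ha, ma, h⟩ := exists_of_anyColor h
  obtain ⟨b, hb, mb, h⟩ := exists_of_anyColor h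
  simp only [Bool.and_eq_true] at h
  obtain ⟨hab, h⟩ := h
  obtain ⟨c, hc, mc, h⟩ := exists_of_anyColor h
  simp only [Bool.and_eq_true] at h
  obtain ⟨hac, hbc, h⟩ := h
  obtain ⟨d, hd, md, h⟩ := exists_of_anyColor h
  simp only [Bool.and_eq_true] at h
  obtain ⟨had, hbd, hcd⟩ := h
  have hvia := @IsLinkage.not_of_compatibleVia _ _ _ _ hL he g hg hlink
  have hac := @hvia 0 2 (by decide) (by decide) a c ha hc ma mc hac
  have hbc := @hvia 1 2 (by decide) (by decide) b c hb hc mb mc hbc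
  have had := @hvia 0 3 (by decide) (by decide) a d ha hd ma md had
  have hbd := @hvia 1 3 (by decide) (by decide) b d hb hd mb md hbd
  exact isAssignment_of_pairs hL he (i := 0) (j := 1) (k := 2) (l := 3) (by decide) (by decide)
    (by decide) (by decide) (by decide) (by decide) ha hb hc hd (compatible_iff.1 hab).1 hac.1
    had.1 hbc.1 hbd.1 (compatible_iff.1 hcd).1 ma mb mc md
    (hL.not_of_compatible he (i := 0) (j := 1) (by decide) ha hb ma mb hab) hac.2 had.2 hbc.2 hbd.2
    (hL.not_of_compatible he (i := 2) (j := 3) (by decide) hc hd mc md hcd)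

end Assignment

/-- Colors for the edges to three vertices seeing the colors in `X`, `Y` and `Z`, such that no two
of them can close a bichromatic cycle. -/
structure IsTriple (X Y Z : Finset (Fin 7)) (a b c : Fin 7) : Prop where
  notMem₁ : a ∉ X
  notMem₂ : b ∉ Y
  notMem₃ : c ∉ Z
  ne₁₂ : a ≠ b
  ne₁₃ : a ≠ c
  ne₂₃ : b ≠ c
  notMem₁₂ : ¬ (b ∈ X ∧ a ∈ Y)
  notMem₁₃ : ¬ (c ∈ X ∧ a ∈ Z)
  notMem₂₃ : ¬ (c ∈ Y ∧ b ∈ Z)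

theorem exists_isTriple_ne {X Y Z : Finset (Fin 7)} (hX : X.card = 3) (hY : Y.card = 3)
    (hZ : Z.card = 3) (A : Finset (Fin 7)) :
    ∃ a b c, IsTriple X Y Z a b c ∧ ({a, b, c} : Finset (Fin 7)) ≠ A := by
  obtain ⟨e, m₁, m₂, m₃, h₁, h₂, -, he, hs⟩ :=
    exists_isEncoding (F := ![X, Y, Z, Z]) (by intro i; fin_cases i <;> assumption)
  have spec : ∀ {P : ℕ → ℕ → ℕ → Bool}, anyTriple 7 m₁ m₂ P = true →
      ∃ a b c, a < 7 ∧ b < 7 ∧ c < 7 ∧ P a b c = true ∧ IsTriple X Y Z (e a) (e b) (e c) := by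
    intro P h
    obtain ⟨a, ha, ma, h⟩ := exists_of_anyColor h
    obtain ⟨b, hb, mb, h⟩ := exists_of_anyColor h
    simp only [Bool.and_eq_true] at h
    obtain ⟨hab, h⟩ := h
    obtain ⟨c, hc, mc, h⟩ := exists_of_anyColor h
    simp only [Bool.and_eq_true, compatible_iff] at h hab
    obtain ⟨hac, hbc, h⟩ := h
    have e0 : ∀ {x}, x < 7 → (bit 7 x = true ↔ e x ∈ X) := he.bit_iff 0
    have e1 : ∀ {x}, x < 7 → (bit m₁ x = true ↔ e x ∈ Y) := he.bit_iff 1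
    have e2 : ∀ {x}, x < 7 → (bit m₂ x = true ↔ e x ∈ Z) := he.bit_iff 2
    refine ⟨a, b, c, ha, hb, hc, h, he.notMem (i := 0) ha ma, he.notMem (i := 1) hb mb,
      he.notMem (i := 2) hc mc, fun h => hab.1 (he.inj ha hb h), fun h => hac.1 (he.inj ha hc h),
      fun h => hbc.1 (he.inj hb hc h), ?_, ?_, ?_⟩
    · rw [← e0 hb, ← e1 ha]; exact hab.2
    · rw [← e0 hc, ← e2 ha]; exact hac.2
    · rw [← e1 hc, ← e2 hb]; exact hbc.2
  have h := anyTriple_anyTriple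
  simp only [List.all_eq_true] at h
  obtain ⟨a, b, c, ha, hb, hc, h, ht⟩ := spec (h m₁ h₁ m₂ h₂)
  obtain ⟨a', b', c', ha', hb', hc', h, ht'⟩ := spec h
  by_cases hA : ({e a, e b, e c} : Finset (Fin 7)) = A
  · refine ⟨e a', e b', e c', ht', fun hA' => ?_⟩
    rw [← hA'] at hA
    have ne : ∀ {x y}, x < 7 → y < 7 → (!Nat.beq x y) = true → e x ≠ e y :=
      fun hx hy h h' => beq_eq_false h (he.inj hx hy h')
    simp only [Bool.or_eq_true, Bool.and_eq_true] at h
    have m0 : e a ∈ ({e a', e b', e c'} : Finset (Fin 7)) := by simp [← hA]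
    have m1 : e b ∈ ({e a', e b', e c'} : Finset (Fin 7)) := by simp [← hA]
    have m2 : e c ∈ ({e a', e b', e c'} : Finset (Fin 7)) := by simp [← hA]
    simp only [Finset.mem_insert, Finset.mem_singleton] at m0 m1 m2
    rcases h with ⟨h, h', h''⟩ | ⟨h, h', h''⟩ | ⟨h, h', h''⟩
    · have := ne ha ha' h
      have := ne ha hb' h'
      have := ne ha hc' h''
      tauto
    · have := ne hb ha' h
      have := ne hb hb' h'
      have := ne hb hc' h''
      tauto
    · have := ne hc ha' h
      have := ne hc hb' h'
      have := ne hc hc' h''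
      tauto
  · exact ⟨_, _, _, ht, hA⟩

section Graph

variable {V α : Type*}

/-- The graph formed by the edges of `G` that avoid the vertex `u`. -/
def edgesAvoiding (G : SimpleGraph V) (u : V) : SimpleGraph V where
  Adj x y := G.Adj x y ∧ x ≠ u ∧ y ≠ u
  symm := ⟨fun _ _ h => ⟨h.1.symm, h.2.2, h.2.1⟩⟩
  loopless := ⟨fun x h => G.loopless.irrefl x h.1⟩

/-- The graph formed by the edges of `G` with both ends in `U`. -/
def edgesWithin (G : SimpleGraph V) (U : Finset V) : SimpleGraph V where
  Adj x y := G.Adj x y ∧ x ∈ U ∧ y ∈ U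
  symm := ⟨fun _ _ h => ⟨h.1.symm, h.2.2, h.2.1⟩⟩
  loopless := ⟨fun x h => G.loopless.irrefl x h.1⟩

/-- The graph formed by the edges of `G` with color `a` or `b`. -/
def bichromatic (G : SimpleGraph V) (c : Sym2 V → α) (a b : α) : SimpleGraph V where
  Adj x y := G.Adj x y ∧ (c s(x, y) = a ∨ c s(x, y) = b)
  symm := ⟨fun x y h => ⟨h.1.symm, by rw [Sym2.eq_swap]; exact h.2⟩⟩
  loopless := ⟨fun x h => G.loopless.irrefl x h.1⟩

/-- The colors of the edges of `G` at `x`. -/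
def seenColors (G : SimpleGraph V) (c : Sym2 V → α) (x : V) : Set α :=
  {a | ∃ y, G.Adj x y ∧ c s(x, y) = a}

theorem edgesAvoiding_le (G : SimpleGraph V) (u : V) : edgesAvoiding G u ≤ G :=
  fun _ _ h => h.1

theorem properEdgeColoring_iff {G : SimpleGraph V} {c : Sym2 V → α} :
    ProperEdgeColoring G c ↔
      ∀ x y z, G.Adj x y → G.Adj x z → c s(x, y) = c s(x, z) → y = z := by
  constructor
  · intro h x y z hy hz hc
    by_contra hne
    exact h s(x, y) hy s(x, z) hz (fun h => hne (Sym2.congr_right.1 h)) ⟨x, by simp⟩ hc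
  · rintro h e₁ h₁ e₂ h₂ hne ⟨v, hv₁, hv₂⟩ hc
    obtain ⟨y, rfl⟩ := hv₁
    obtain ⟨z, rfl⟩ := hv₂
    exact hne (by rw [h v y z h₁ h₂ hc])

theorem AcyclicEdgeColoring.mono {G H : SimpleGraph V} {c : Sym2 V → α}
    (h : AcyclicEdgeColoring G c) (hle : H ≤ G) : AcyclicEdgeColoring H c := by
  refine ⟨fun e₁ h₁ e₂ h₂ => h.1 e₁ (SimpleGraph.edgeSet_mono hle h₁) e₂
    (SimpleGraph.edgeSet_mono hle h₂), fun v w hw => ?_⟩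
  have := h.2 v (w.mapLe hle) (hw.mapLe hle)
  simpa using this

theorem bichromatic_swap (G : SimpleGraph V) (c : Sym2 V → α) (a b : α) :
    bichromatic G c a b = bichromatic G c b a := by
  ext x y
  simp [bichromatic, or_comm]

theorem SimpleGraph.Reachable.exists_adj {G : SimpleGraph V} {x y : V} (h : G.Reachable x y)
    (hne : x ≠ y) : ∃ z, G.Adj x z := by
  obtain ⟨w⟩ := h
  cases w with
  | nil => exact absurd rfl hne
  | cons h _ => exact ⟨_, h⟩

theorem mem_seenColors_of_reachable {G : SimpleGraph V} {c : Sym2 V → α} {a b : α} {x y : V}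
    (h : (bichromatic G c a b).Reachable x y) (hne : x ≠ y) (ha : a ∉ seenColors G c x) :
    b ∈ seenColors G c x := by
  obtain ⟨z, hz, hc⟩ := h.exists_adj hne
  rcases hc with hc | hc
  · exact absurd ⟨z, hz, hc⟩ ha
  · exact ⟨z, hz, hc⟩

/-- In a graph of maximum degree two, at most one vertex of degree one other than `o` can be
reached from a neighbor of `o` without returning to `o`. -/
theorem SimpleGraph.Walk.end_unique {G : SimpleGraph V}
    (hG : ∀ x y z w, G.Adj x y → G.Adj x z → G.Adj x w → y = z ∨ y = w ∨ z = w) {q r : V}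
    (hq : ∀ y z, G.Adj q y → G.Adj q z → y = z) (hr : ∀ y z, G.Adj r y → G.Adj r z → y = z)
    {x : V} (p : G.Walk x q) : ∀ (p' : G.Walk x r) (o : V), G.Adj o x → p.IsPath → p'.IsPath →
      o ∉ p.support → o ∉ p'.support → q = r := by
  induction p with
  | nil =>
    intro p' o ho _ _ _ hs
    cases p' with
    | nil => rfl
    | cons h p' =>
      exact absurd (hq _ _ ho.symm h) (by rintro rfl; simp at hs)
  | cons h p ih =>
    intro p' o ho hp hp' hs hs'
    cases p' with
    | nil => exact absurd (hr _ _ ho.symm h) (by rintro rfl; simp at hs)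
    | cons h' p' =>
      rw [SimpleGraph.Walk.cons_isPath_iff] at hp hp'
      rw [SimpleGraph.Walk.support_cons, List.mem_cons, not_or] at hs hs'
      rcases hG _ _ _ _ ho.symm h h' with rfl | rfl | rfl
      · exact absurd p.start_mem_support hs.2
      · exact absurd p'.start_mem_support hs'.2
      · exact ih hq p' _ h hp.1 hp'.1 hp.2 hp'.2

theorem not_reachable_of_degree_le_one {G : SimpleGraph V}
    (hG : ∀ x y z w, G.Adj x y → G.Adj x z → G.Adj x w → y = z ∨ y = w ∨ z = w) {p q r : V}
    (hp : ∀ y z, G.Adj p y → G.Adj p z → y = z) (hq : ∀ y z, G.Adj q y → G.Adj q z → y = z)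
    (hr : ∀ y z, G.Adj r y → G.Adj r z → y = z) (hpq : p ≠ q) (hpr : p ≠ r) (hqr : q ≠ r)
    (h : G.Reachable p q) : ¬ G.Reachable p r := by
  intro h'
  obtain ⟨w, hw⟩ := h.exists_isPath
  obtain ⟨w', hw'⟩ := h'.exists_isPath
  cases w with
  | nil => exact hpq rfl
  | cons e w =>
    cases w' with
    | nil => exact hpr rfl
    | cons e' w' =>
      rw [SimpleGraph.Walk.cons_isPath_iff] at hw hw'
      obtain rfl := hp _ _ e e'
      exact hqr (w.end_unique hG hq hr w' p e hw.1 hw'.1 hw.2 hw'.2)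

theorem bichromatic_adj_eq {G : SimpleGraph V} {c : Sym2 V → α} (hc : ProperEdgeColoring G c)
    {a b : α} {x y z w : V} (hy : (bichromatic G c a b).Adj x y)
    (hz : (bichromatic G c a b).Adj x z) (hw : (bichromatic G c a b).Adj x w) :
    y = z ∨ y = w ∨ z = w := by
  rw [properEdgeColoring_iff] at hc
  have h₁ := hc x y z hy.1 hz.1
  have h₂ := hc x y w hy.1 hw.1
  have h₃ := hc x z w hz.1 hw.1
  rcases hy.2 with hy | hy <;> rcases hz.2 with hz | hz <;> rcases hw.2 with hw | hw <;>
    simp_all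

theorem bichromatic_adj_unique {G : SimpleGraph V} {c : Sym2 V → α}
    (hc : ProperEdgeColoring G c) {a b : α} {x y z : V}
    (hx : a ∉ seenColors G c x ∨ b ∉ seenColors G c x) (hy : (bichromatic G c a b).Adj x y)
    (hz : (bichromatic G c a b).Adj x z) : y = z := by
  rw [properEdgeColoring_iff] at hc
  have h₁ := hc x y z hy.1 hz.1
  have h₂ : c s(x, y) ∈ seenColors G c x := ⟨y, hy.1, rfl⟩
  have h₃ : c s(x, z) ∈ seenColors G c x := ⟨z, hz.1, rfl⟩
  rcases hy.2 with hy | hy <;> rcases hz.2 with hz | hz <;> simp_all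

/-- Coloring the edges at a new vertex `u` by distinct colors that are not seen by their other
ends and do not close a bichromatic cycle. -/
theorem AcyclicEdgeColoring.extend {G : SimpleGraph V} {u : V} {c : Sym2 V → α}
    (hc : AcyclicEdgeColoring (edgesAvoiding G u) c) (g : V → α)
    (hinj : ∀ x y, G.Adj u x → G.Adj u y → g x = g y → x = y)
    (hseen : ∀ x, G.Adj u x → g x ∉ seenColors (edgesAvoiding G u) c x)
    (hlink : ∀ x y, G.Adj u x → G.Adj u y → x ≠ y →
      ¬ (bichromatic (edgesAvoiding G u) c (g x) (g y)).Reachable x y) :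
    ∃ c', AcyclicEdgeColoring G c' ∧ (∀ x, c' s(u, x) = g x) ∧ ∀ e, u ∉ e → c' e = c e := by
  classical
  let c' : Sym2 V → α := fun e => if h : u ∈ e then g (Sym2.Mem.other h) else c e
  have hu : ∀ x, c' s(u, x) = g x := by
    intro x
    have h : u ∈ s(u, x) := Sym2.mem_mk_left u x
    have h' : Sym2.Mem.other h = x := Sym2.congr_right.1 (Sym2.other_spec h)
    simp only [c', dif_pos h, h']
  have hu' : ∀ x, c' s(x, u) = g x := fun x => by rw [Sym2.eq_swap, hu]
  have hne : ∀ e, u ∉ e → c' e = c e := fun e h => dif_neg h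
  have hne' : ∀ x y, x ≠ u → y ≠ u → c' s(x, y) = c s(x, y) := fun x y hx hy =>
    hne _ (by simpa using ⟨hx.symm, hy.symm⟩)
  refine ⟨c', ⟨properEdgeColoring_iff.2 fun x y z hy hz h => ?_, fun v w hw => ?_⟩, hu, hne⟩
  · rcases eq_or_ne x u with rfl | hx
    · rw [hu, hu] at h
      exact hinj y z hy hz h
    rcases eq_or_ne y u with rfl | hyu
    · rcases eq_or_ne z y with rfl | hzu
      · rfl
      rw [hu', hne' _ _ hx hzu] at h
      exact absurd ⟨z, ⟨hz, hx, hzu⟩, h.symm⟩ (hseen x hy.symm)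
    rcases eq_or_ne z u with rfl | hzu
    · rw [hu', hne' _ _ hx hyu] at h
      exact absurd ⟨y, ⟨hy, hx, hyu⟩, h⟩ (hseen x hz.symm)
    rw [hne' _ _ hx hyu, hne' _ _ hx hzu] at h
    exact properEdgeColoring_iff.1 hc.1 x y z ⟨hy, hx, hyu⟩ ⟨hz, hx, hzu⟩ h
  rintro ⟨i, j, hij⟩
  have avoid : ∀ {x y : V} (p : G.Walk x y), u ∉ p.support → ∀ e ∈ p.edges,
      e ∈ (edgesAvoiding G u).edgeSet ∧ c' e = c e := by
    intro x y p hp e he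
    induction e with
    | _ s t =>
      have hs : s ≠ u := fun h => hp (h ▸ p.fst_mem_support_of_mem_edges he)
      have ht : t ≠ u := fun h => hp (h ▸ p.snd_mem_support_of_mem_edges he)
      exact ⟨⟨p.edges_subset_edgeSet he, hs, ht⟩, hne' s t hs ht⟩
  by_cases hus : u ∈ w.support
  · have hw' := hw.rotate hus
    have hij' : ∀ e ∈ (w.rotate u hus).edges, c' e = i ∨ c' e = j := fun e he =>
      hij e ((w.rotate_edges u hus).mem_iff.1 he)
    generalize w.rotate u hus = w' at hw' hij'
    cases w' with
    | nil => exact hw'.not_nil .nil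
    | @cons _ x _ hx p =>
      rw [SimpleGraph.Walk.cons_isCycle_iff] at hw'
      obtain ⟨hp, hpe⟩ := hw'
      have hp := hp.reverse
      have hpe : s(u, x) ∉ p.reverse.edges := by simpa using hpe
      have hij₁ : ∀ e ∈ p.reverse.edges, c' e = i ∨ c' e = j := fun e he =>
        hij' e (by simp only [SimpleGraph.Walk.edges_reverse, List.mem_reverse] at he; simp [he])
      have hij₂ := hij' s(u, x) (by simp)
      generalize p.reverse = p' at hp hpe hij₁
      cases p' with
      | nil => exact G.loopless.irrefl _ hx
      | @cons _ y _ hy q =>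
        rw [SimpleGraph.Walk.cons_isPath_iff] at hp
        have hij₃ := hij₁ s(u, y) (by simp)
        have hxy : x ≠ y := by
          rintro rfl
          simp at hpe
        rw [hu] at hij₂ hij₃
        have hg : g x ≠ g y := fun h => hxy (hinj x y hx hy h)
        refine hlink y x hy hx hxy.symm ⟨q.transfer _ fun e he => ?_⟩
        have he' := hij₁ e (by simp [he])
        obtain ⟨hH, hce⟩ := avoid q hp.2 e he
        rw [hce] at he'
        induction e with
        | _ s t =>
          refine ⟨hH, ?_⟩
          rcases hij₂ with h | h <;> rcases hij₃ with h' | h' <;> rw [h, h'] at hg ⊢ <;> tauto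
  · refine hc.2 v (w.transfer _ fun e he => (avoid w hus e he).1) (hw.transfer _) ⟨i, j, ?_⟩
    intro e he
    rw [SimpleGraph.Walk.edges_transfer] at he
    rw [← (avoid w hus e he).2]
    exact hij e he

end Graph

section Extension

variable {V : Type*} {G : SimpleGraph V} {u : V} {c : Sym2 V → Fin 7} {nb : Fin 4 → V}
  {F : Fin 4 → Finset (Fin 7)}

/-- `nb` lists the neighbors of `u`, without repetition except for possible padding. -/
structure IsNeighborList (G : SimpleGraph V) (u : V) (nb : Fin 4 → V) : Prop where
  exists_eq : ∀ x, G.Adj u x → ∃ i, nb i = x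
  inj : ∀ {i j}, G.Adj u (nb i) → nb i = nb j → i = j

/-- The sets `F` consist of three colors and contain the colors seen by the neighbors of `u`. -/
structure IsCover (G : SimpleGraph V) (u : V) (c : Sym2 V → Fin 7) (nb : Fin 4 → V)
    (F : Fin 4 → Finset (Fin 7)) : Prop where
  card_eq : ∀ i, (F i).card = 3
  subset : ∀ i, G.Adj u (nb i) → seenColors (edgesAvoiding G u) c (nb i) ⊆ F i

/-- The neighbors with numbers `i` and `j` are linked by a path with colors `a` and `b`. -/
def Linked (G : SimpleGraph V) (u : V) (c : Sym2 V → Fin 7) (nb : Fin 4 → V) (i j : Fin 4)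
    (a b : Fin 7) : Prop :=
  G.Adj u (nb i) ∧ G.Adj u (nb j) ∧
    (bichromatic (edgesAvoiding G u) c a b).Reachable (nb i) (nb j)

theorem IsNeighborList.comp (h : IsNeighborList G u nb) (τ : Equiv.Perm (Fin 4)) :
    IsNeighborList G u (nb ∘ τ) where
  exists_eq x hx := by
    obtain ⟨i, rfl⟩ := h.exists_eq x hx
    exact ⟨τ.symm i, by simp⟩
  inj hi hij := τ.injective (h.inj hi hij)

theorem IsCover.comp (h : IsCover G u c nb F) (τ : Equiv.Perm (Fin 4)) :
    IsCover G u c (nb ∘ τ) (F ∘ τ) where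
  card_eq i := h.card_eq (τ i)
  subset i := h.subset (τ i)

theorem exists_isNeighborList [Finite V] (h : (G.neighborSet u).ncard ≤ 4) :
    ∃ nb, IsNeighborList G u nb := by
  classical
  let l := (G.neighborSet u).toFinite.toFinset.toList
  have hl : l.length ≤ 4 := by
    simpa [l, Set.ncard_eq_toFinset_card _ (G.neighborSet u).toFinite] using h
  have hmem : ∀ x, x ∈ l ↔ G.Adj u x := by simp [l]
  refine ⟨fun i => l.getD i u, fun x hx => ?_, fun {i j} hi hij => ?_⟩
  · obtain ⟨i, hi, rfl⟩ := List.getElem_of_mem ((hmem x).2 hx)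
    exact ⟨⟨i, by omega⟩, by simp [hi]⟩
  · have key : ∀ k : Fin 4, G.Adj u (l.getD k u) → (k : ℕ) < l.length := by
      intro k hk
      by_contra hlt
      rw [List.getD_eq_default _ _ (by omega)] at hk
      exact G.loopless.irrefl _ hk
    have hi' := key i hi
    have hj' := key j (by simpa only [hij] using hi)
    simp only [List.getD_eq_getElem _ _ hi', List.getD_eq_getElem _ _ hj'] at hij
    exact Fin.ext ((Finset.nodup_toList _).getElem_inj_iff.1 hij)

theorem isLinkage_linked (hc : AcyclicEdgeColoring (edgesAvoiding G u) c)
    (hnb : IsNeighborList G u nb) (hF : IsCover G u c nb F) :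
    IsLinkage F (Linked G u c nb) where
  symm h := ⟨h.2.1, h.1, h.2.2.symm⟩
  swap h := ⟨h.1, h.2.1, bichromatic_swap (edgesAvoiding G u) c _ _ ▸ h.2.2⟩
  mem {i j a b} h hij _ ha hb := by
    have hne : nb i ≠ nb j := fun h' => hij (hnb.inj h.1 h')
    refine ⟨hF.subset i h.1 (mem_seenColors_of_reachable h.2.2 hne
        fun h' => ha (hF.subset i h.1 h')), hF.subset j h.2.1 ?_⟩
    refine mem_seenColors_of_reachable (a := b) ?_ hne.symm fun h' => hb (hF.subset j h.2.1 h')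
    exact bichromatic_swap (edgesAvoiding G u) c _ _ ▸ h.2.2.symm
  unique {i j k a b} h h' hij hik hjk _ hi hj hk := by
    have seen : ∀ t, G.Adj u (nb t) → (a ∉ F t ∨ b ∉ F t) →
        ∀ y z, (bichromatic (edgesAvoiding G u) c a b).Adj (nb t) y →
          (bichromatic (edgesAvoiding G u) c a b).Adj (nb t) z → y = z := by
      intro t ht hab y z
      exact bichromatic_adj_unique hc.1
        (hab.imp (fun h h' => h (hF.subset t ht h')) (fun h h' => h (hF.subset t ht h')))
    exact not_reachable_of_degree_le_one (fun x y z w => bichromatic_adj_eq hc.1)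
      (seen i h.1 hi) (seen j h.2.1 hj) (seen k h'.2.1 hk) (fun e => hij (hnb.inj h.1 e))
      (fun e => hik (hnb.inj h.1 e)) (fun e => hjk (hnb.inj h.2.1 e)) h.2.2 h'.2.2

theorem IsAssignment.exists_acyclic {f : Fin 4 → Fin 7} (hf : IsAssignment F (Linked G u c nb) f)
    (hc : AcyclicEdgeColoring (edgesAvoiding G u) c)
    (hnb : IsNeighborList G u nb) (hF : IsCover G u c nb F) :
    ∃ c' : Sym2 V → Fin 7, AcyclicEdgeColoring G c' := by
  classical
  choose idx hidx using hnb.exists_eq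
  obtain ⟨hinj, hmem, hlink⟩ := hf
  let g : V → Fin 7 := fun x => if h : G.Adj u x then f (idx x h) else 0
  have hg : ∀ x (h : G.Adj u x), g x = f (idx x h) := fun x h => dif_pos h
  obtain ⟨c', hc', -⟩ := hc.extend g
    (fun x y hx hy h => by
      rw [hg x hx, hg y hy] at h
      rw [← hidx x hx, ← hidx y hy, hinj h])
    (fun x hx h => by
      rw [hg x hx] at h
      refine hmem _ (hF.subset (idx x hx) (by rwa [hidx]) ?_)
      rwa [hidx])
    (fun x y hx hy hne h => by
      rw [hg x hx, hg y hy] at h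
      refine hlink (idx x hx) (idx y hy) (fun h' => hne ?_) ⟨?_, ?_, ?_⟩
      · rw [← hidx x hx, ← hidx y hy, h']
      · rwa [hidx]
      · rwa [hidx]
      · rwa [hidx, hidx])
  exact ⟨c', hc'⟩

theorem exists_acyclic_of_not_evenlyCovered (hc : AcyclicEdgeColoring (edgesAvoiding G u) c)
    (hnb : IsNeighborList G u nb) (hF : IsCover G u c nb F) (h : ¬ EvenlyCovered F) :
    ∃ c' : Sym2 V → Fin 7, AcyclicEdgeColoring G c' := by
  obtain ⟨f, hf⟩ := (isLinkage_linked hc hnb hF).exists_of_not_evenlyCovered hF.card_eq h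
  exact hf.exists_acyclic hc hnb hF

theorem exists_acyclic_of_adj (hc : AcyclicEdgeColoring (edgesAvoiding G u) c)
    (hnb : IsNeighborList G u nb) (hF : IsCover G u c nb F) {x y : V} (hx : G.Adj u x)
    (hy : G.Adj u y) (hxy : G.Adj x y) : ∃ c' : Sym2 V → Fin 7, AcyclicEdgeColoring G c' := by
  obtain ⟨i, rfl⟩ := hnb.exists_eq x hx
  obtain ⟨j, rfl⟩ := hnb.exists_eq y hy
  have hij : i ≠ j := by
    rintro rfl
    exact G.loopless.irrefl _ hxy
  obtain ⟨τ, hτ₀, hτ₁⟩ : ∃ τ : Equiv.Perm (Fin 4), τ 0 = i ∧ τ 1 = j := by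
    clear * - hij
    revert i j
    decide +kernel
  replace hnb := hnb.comp τ
  replace hF := hF.comp τ
  by_cases h : EvenlyCovered (F ∘ τ)
  · have hxy : (edgesAvoiding G u).Adj (nb (τ 0)) (nb (τ 1)) :=
      hτ₀ ▸ hτ₁ ▸ ⟨hxy, hx.ne', hy.ne'⟩
    rw [← hτ₀] at hx
    rw [← hτ₁] at hy
    obtain ⟨f, hf⟩ := (isLinkage_linked hc hnb hF).exists_of_evenlyCovered hF.card_eq h
      (g := c s(nb (τ 0), nb (τ 1))) (hF.subset 0 hx ⟨_, hxy, rfl⟩)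
      (hF.subset 1 hy ⟨_, hxy.symm, by rw [Sym2.eq_swap]; rfl⟩)
      (fun b _ _ => ⟨hx, hy, SimpleGraph.Adj.reachable ⟨hxy, .inl rfl⟩⟩)
    exact hf.exists_acyclic hc hnb hF
  · exact exists_acyclic_of_not_evenlyCovered hc hnb hF h

theorem EvenlyCovered.not_update (h : EvenlyCovered F) {X : Finset (Fin 7)} (hX : X ≠ F 0) :
    ¬ EvenlyCovered (Function.update F 0 X) := by
  intro h'
  refine hX (Finset.ext fun x => ?_)
  have h₁ := h x
  have h₂ := h' x
  simp only [Function.update_self, Function.update_of_ne (show (3 : Fin 4) ≠ 0 by decide),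
    Function.update_of_ne (show (1 : Fin 4) ≠ 0 by decide),
    Function.update_of_ne (show (2 : Fin 4) ≠ 0 by decide)] at h₂
  unfold Xor at h₁ h₂
  tauto

theorem seenColors_eq_image (G : SimpleGraph V) (c : Sym2 V → Fin 7) (x : V) :
    seenColors G c x = (fun y => c s(x, y)) '' G.neighborSet x := rfl

theorem ncard_edgesAvoiding_le [Finite V] {x : V} (hx : G.Adj u x)
    (h : (G.neighborSet x).ncard ≤ 4) : ((edgesAvoiding G u).neighborSet x).ncard ≤ 3 := by
  have hsub : (edgesAvoiding G u).neighborSet x ⊆ G.neighborSet x \ {u} :=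
    fun y hy => ⟨hy.1, hy.2.2⟩
  have h₁ := Set.ncard_le_ncard hsub (Set.toFinite _)
  have h₂ := Set.ncard_sdiff_singleton_of_mem (s := G.neighborSet x) (a := u) hx.symm
  omega

theorem exists_superset_seenColors {x : V} [Finite V] (h : (G.neighborSet x).ncard ≤ 3) :
    ∃ X : Finset (Fin 7), X.card = 3 ∧ seenColors G c x ⊆ X := by
  classical
  have hle : (seenColors G c x).ncard ≤ 3 := by
    rw [seenColors_eq_image]
    exact (Set.ncard_image_le (Set.toFinite _)).trans h
  rw [Set.ncard_eq_toFinset_card _ (Set.toFinite _)] at hle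
  obtain ⟨X, hX, hcard⟩ := Finset.exists_superset_card_eq hle (by simp)
  exact ⟨X, hcard, fun a ha => hX (by simpa using ha)⟩

/-- Three colors containing fewer than three given ones can be replaced by others. -/
theorem exists_superset_ne {S : Set (Fin 7)} {A : Finset (Fin 7)} (hA : A.card = 3)
    (hS : S ⊆ A) (h : S.ncard < 3) : ∃ X, X ≠ A ∧ X.card = 3 ∧ S ⊆ X := by
  obtain ⟨w, hw, hwS⟩ : ∃ w ∈ A, w ∉ S := by
    by_contra! hc
    have := Set.ncard_le_ncard (show (A : Set (Fin 7)) ⊆ S from hc) (Set.toFinite _)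
    rw [Set.ncard_coe_finset] at this
    omega
  obtain ⟨z, hz⟩ : ∃ z, z ∉ A := by
    by_contra! hc
    rw [Finset.eq_univ_iff_forall.2 hc] at hA
    simp at hA
  refine ⟨insert z (A.erase w), fun h => hz (h ▸ Finset.mem_insert_self _ _), ?_, fun a ha => ?_⟩
  · rw [Finset.card_insert_of_notMem (by simp [hz]), Finset.card_erase_of_mem hw, hA]
  · have : a ≠ w := by
      rintro rfl
      exact hwS ha
    simp [this, Finset.mem_coe.1 (hS ha)]

/-- The edges at a vertex of degree three can be recolored so that the set of colors changes. -/
theorem exists_recoloring [Finite V] {a : V} (hc : AcyclicEdgeColoring G c)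
    (hdeg : ∀ x, (G.neighborSet x).ncard ≤ 4) (ha : (G.neighborSet a).ncard = 3)
    (A : Finset (Fin 7)) :
    ∃ (c' : Sym2 V → Fin 7) (X : Finset (Fin 7)), AcyclicEdgeColoring G c' ∧ X ≠ A ∧
      X.card = 3 ∧ seenColors G c' a ⊆ X ∧ ∀ e, a ∉ e → c' e = c e := by
  classical
  obtain ⟨x, y, z, hxy, hxz, hyz, hN⟩ := Set.ncard_eq_three.1 ha
  have hN : ∀ v, G.Adj a v ↔ v = x ∨ v = y ∨ v = z := fun v => by
    rw [← SimpleGraph.mem_neighborSet, hN]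
    simp
  have hx : G.Adj a x := (hN x).2 (by simp)
  have hy : G.Adj a y := (hN y).2 (by simp)
  have hz : G.Adj a z := (hN z).2 (by simp)
  have hc' := hc.mono (edgesAvoiding_le G a)
  obtain ⟨X, hX, hXs⟩ := exists_superset_seenColors (c := c)
    (ncard_edgesAvoiding_le hx (hdeg x))
  obtain ⟨Y, hY, hYs⟩ := exists_superset_seenColors (c := c)
    (ncard_edgesAvoiding_le hy (hdeg y))
  obtain ⟨Z, hZ, hZs⟩ := exists_superset_seenColors (c := c)
    (ncard_edgesAvoiding_le hz (hdeg z))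
  obtain ⟨α, β, γ, h, hA⟩ := exists_isTriple_ne hX hY hZ A
  let g : V → Fin 7 := fun v => if v = x then α else if v = y then β else γ
  have gx : g x = α := by simp [g]
  have gy : g y = β := by simp [g, hxy.symm]
  have gz : g z = γ := by simp [g, hxz.symm, hyz.symm]
  have link : ∀ {s t : V} {S T : Finset (Fin 7)} {a' b' : Fin 7}, s ≠ t →
      seenColors (edgesAvoiding G a) c s ⊆ S → seenColors (edgesAvoiding G a) c t ⊆ T →
      a' ∉ S → b' ∉ T → ¬ (b' ∈ S ∧ a' ∈ T) →
      ¬ (bichromatic (edgesAvoiding G a) c a' b').Reachable s t ∧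
      ¬ (bichromatic (edgesAvoiding G a) c b' a').Reachable t s := by
    intro s t S T a' b' hst hS hT ha hb hab
    have key : ¬ (bichromatic (edgesAvoiding G a) c a' b').Reachable s t := fun hr =>
      hab ⟨hS (mem_seenColors_of_reachable hr hst fun h => ha (hS h)),
        hT (mem_seenColors_of_reachable
          (bichromatic_swap (edgesAvoiding G a) c a' b' ▸ hr.symm) hst.symm fun h => hb (hT h))⟩
    exact ⟨key, fun hr => key (bichromatic_swap (edgesAvoiding G a) c b' a' ▸ hr.symm)⟩
  have lxy := link hxy hXs hYs h.notMem₁ h.notMem₂ h.notMem₁₂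
  have lxz := link hxz hXs hZs h.notMem₁ h.notMem₃ h.notMem₁₃
  have lyz := link hyz hYs hZs h.notMem₂ h.notMem₃ h.notMem₂₃
  obtain ⟨c', hc', hcu, hce⟩ := hc'.extend g
    (by
      have h₁ := h.ne₁₂
      have h₂ := h.ne₁₃
      have h₃ := h.ne₂₃
      intro s t hs ht he
      rcases (hN s).1 hs with rfl | rfl | rfl <;> rcases (hN t).1 ht with rfl | rfl | rfl <;>
        first
        | rfl
        | (simp only [gx, gy, gz] at he
           first
           | exact absurd he ‹_›
           | exact absurd he.symm ‹_›))
    (by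
      intro s hs
      rcases (hN s).1 hs with rfl | rfl | rfl
      · exact fun h' => h.notMem₁ (hXs (gx ▸ h'))
      · exact fun h' => h.notMem₂ (hYs (gy ▸ h'))
      · exact fun h' => h.notMem₃ (hZs (gz ▸ h')))
    (by
      intro s t hs ht hst
      rcases (hN s).1 hs with hs | hs | hs <;> rcases (hN t).1 ht with ht | ht | ht <;>
        rw [hs, ht] at hst ⊢ <;> simp only [gx, gy, gz] <;>
        first
        | exact absurd rfl hst
        | exact lxy.1
        | exact lxy.2
        | exact lxz.1
        | exact lxz.2
        | exact lyz.1
        | exact lyz.2)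
  refine ⟨c', {α, β, γ}, hc', hA, Finset.card_eq_three.2 ⟨α, β, γ, h.ne₁₂, h.ne₁₃, h.ne₂₃, rfl⟩,
    ?_, hce⟩
  rintro _ ⟨v, hv, rfl⟩
  rw [hcu]
  rcases (hN v).1 hv with rfl | rfl | rfl
  · simp [gx]
  · simp [gy]
  · simp [gz]

theorem exists_acyclic_of_edgesAvoiding [Finite V] (hdeg : ∀ x, (G.neighborSet x).ncard ≤ 4)
    (hc : AcyclicEdgeColoring (edgesAvoiding G u) c) :
    ∃ c' : Sym2 V → Fin 7, AcyclicEdgeColoring G c' := by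
  classical
  obtain ⟨nb, hnb⟩ := exists_isNeighborList (hdeg u)
  have hF : ∀ i, ∃ X : Finset (Fin 7), X.card = 3 ∧
      (G.Adj u (nb i) → seenColors (edgesAvoiding G u) c (nb i) ⊆ X) := by
    intro i
    by_cases hi : G.Adj u (nb i)
    · obtain ⟨X, hX, hs⟩ := exists_superset_seenColors (c := c)
        (ncard_edgesAvoiding_le hi (hdeg (nb i)))
      exact ⟨X, hX, fun _ => hs⟩
    · exact ⟨{0, 1, 2}, rfl, fun h => absurd h hi⟩
  choose F hcard hsub using hF
  have hF : IsCover G u c nb F := ⟨hcard, hsub⟩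
  by_cases htri : ∃ x y, G.Adj u x ∧ G.Adj u y ∧ G.Adj x y
  · obtain ⟨x, y, hx, hy, hxy⟩ := htri
    exact exists_acyclic_of_adj hc hnb hF hx hy hxy
  by_cases heven : EvenlyCovered F
  swap
  · exact exists_acyclic_of_not_evenlyCovered hc hnb hF heven
  obtain ⟨c', X, hc', hX, hXcard, hXsub, hce⟩ : ∃ (c' : Sym2 V → Fin 7) (X : Finset (Fin 7)),
      AcyclicEdgeColoring (edgesAvoiding G u) c' ∧ X ≠ F 0 ∧ X.card = 3 ∧
      (G.Adj u (nb 0) → seenColors (edgesAvoiding G u) c' (nb 0) ⊆ X) ∧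
      ∀ e, ¬ (G.Adj u (nb 0) ∧ nb 0 ∈ e) → c' e = c e := by
    by_cases h0 : G.Adj u (nb 0)
    · by_cases hlt : (seenColors (edgesAvoiding G u) c (nb 0)).ncard < 3
      · obtain ⟨X, hX, hXcard, hXsub⟩ := exists_superset_ne (hcard 0) (hsub 0 h0) hlt
        exact ⟨c, X, hc, hX, hXcard, fun _ => hXsub, fun _ _ => rfl⟩
      · have h₁ := ncard_edgesAvoiding_le h0 (hdeg (nb 0))
        have h₂ := Set.ncard_image_le (f := fun y => c s(nb 0, y))
          ((edgesAvoiding G u).neighborSet (nb 0)).toFinite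
        rw [← seenColors_eq_image] at h₂
        obtain ⟨c', X, hc', hX, hXcard, hXsub, hce⟩ := exists_recoloring hc
          (fun x => (Set.ncard_le_ncard (fun y hy => hy.1) (Set.toFinite _)).trans (hdeg x))
          (a := nb 0) (by omega) (F 0)
        exact ⟨c', X, hc', hX, hXcard, fun _ => hXsub, fun e he => hce e fun h => he ⟨h0, h⟩⟩
    · obtain ⟨X, hX, hXcard, -⟩ := exists_superset_ne (hcard 0) (Set.empty_subset _) (by simp)
      exact ⟨c, X, hc, hX, hXcard, fun h => absurd h h0, fun _ _ => rfl⟩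
  refine exists_acyclic_of_not_evenlyCovered hc' hnb (F := Function.update F 0 X) ⟨?_, ?_⟩
    (heven.not_update hX)
  · intro i
    rcases eq_or_ne i 0 with rfl | hi
    · simpa using hXcard
    · simpa [hi] using hcard i
  · intro i hi
    rcases eq_or_ne i 0 with rfl | hi0
    · simpa using hXsub hi
    · rw [Function.update_of_ne hi0]
      rintro _ ⟨y, hy, rfl⟩
      by_cases h : G.Adj u (nb 0) ∧ nb 0 ∈ s(nb i, y)
      · rcases Sym2.mem_iff.1 h.2 with h' | h'
        · exact absurd (hnb.inj hi h'.symm) hi0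
        · exact absurd ⟨nb i, nb 0, hi, h.1, h' ▸ hy.1⟩ htri
      · exact hsub i hi ⟨y, hy, (hce _ h).symm⟩

theorem exists_acyclic_edgesWithin [Finite V] (hdeg : ∀ x, (G.neighborSet x).ncard ≤ 4)
    (U : Finset V) : ∃ c : Sym2 V → Fin 7, AcyclicEdgeColoring (edgesWithin G U) c := by
  classical
  induction U using Finset.induction_on with
  | empty =>
    refine ⟨fun _ => 0, properEdgeColoring_iff.2 fun x y z hy => ?_, fun v w hw => ?_⟩
    · exact absurd hy.2.1 (Finset.notMem_empty _)
    · cases w with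
      | nil => exact absurd .nil hw.not_nil
      | cons h _ => exact absurd h.2.1 (Finset.notMem_empty _)
  | insert u U hu ih =>
    obtain ⟨c, hc⟩ := ih
    refine exists_acyclic_of_edgesAvoiding (u := u) (c := c)
      (fun x => (Set.ncard_le_ncard (fun y hy => hy.1) (Set.toFinite _)).trans (hdeg x))
      (hc.mono fun x y h => ?_)
    obtain ⟨⟨h, hx, hy⟩, hxu, hyu⟩ := h
    exact ⟨h, Finset.mem_of_mem_insert_of_ne hx hxu, Finset.mem_of_mem_insert_of_ne hy hyu⟩

end Extension

theorem acyclic_chromatic_index_maxdeg_four {V : Type*} [Fintype V] (G : SimpleGraph V)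
    (h : maxDeg G ≤ 4) :
    ∃ c : Sym2 V → Fin 7, AcyclicEdgeColoring G c := by
  have hdeg : ∀ x, (G.neighborSet x).ncard ≤ 4 := fun x =>
    (Finset.le_sup (f := fun v => deg G v) (Finset.mem_univ x)).trans h
  obtain ⟨c, hc⟩ := exists_acyclic_edgesWithin hdeg Finset.univ
  exact ⟨c, hc.mono fun x y h => ⟨h, Finset.mem_univ x, Finset.mem_univ y⟩⟩
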